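/- Let μ_n denote the Möbius function of the absolute order on S_n with a maximum element 1̂ adjoined, and let χ̃(Δ(P̄_n)) = μ_n(e, 1̂) be the reduced Euler characteristic of the order complex of the proper part. Then ∑_{n≥1} (−1)^n χ̃(Δ(P̄_n)) t^n / n! = 1 − C(t)·exp(−2t·C(t)), where C(t) = (1 − √(1−4t))/(2t). -/

import Mathlib

open scoped Classical

/-- The reflection length of a permutation `w`: the smallest number of
transpositions whose product is `w`. -/
noncomputable def reflLen {n : ℕ} (w : Equiv.Perm (Fin n)) : ℕ :=
  sInf {k | ∃ l : List (Equiv.Perm (Fin n)), l.length = k ∧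
    (∀ t ∈ l, t.IsSwap) ∧ l.prod = w}

/-- The absolute order on `S_n`: `u ⪯ v` iff `ℓ_T u + ℓ_T (u⁻¹ v) = ℓ_T v`. -/
def AbsLe {n : ℕ} (u v : Equiv.Perm (Fin n)) : Prop :=
  reflLen u + reflLen (u⁻¹ * v) = reflLen v

/-- The generating function `C(t) = (1 - √(1-4t))/(2t)` for the Catalan
numbers. -/
noncomputable def catGF (t : ℝ) : ℝ := (1 - Real.sqrt (1 - 4 * t)) / (2 * t)

open Finset Equiv

section Cycles

variable {α : Type*} [Fintype α] [DecidableEq α]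

/-- The set of points in the same cycle of `w` as `x`. -/
noncomputable def cyc (w : Perm α) (x : α) : Finset α := univ.filter (w.SameCycle x)

/-- The set of cycles of `w`, fixed points included, as sets of points. -/
noncomputable def blocks (w : Perm α) : Finset (Finset α) := univ.image (cyc w)

/-- The product over the cycles of `w`, fixed points included, of a weight depending on their
length. -/
noncomputable def wt {R : Type*} [CommMonoid R] (c : ℕ → R) (w : Perm α) : R :=
  ∏ B ∈ blocks w, c #B

lemma mem_cyc {w : Perm α} {x y : α} : y ∈ cyc w x ↔ w.SameCycle x y := by simp [cyc]

lemma self_mem_cyc (w : Perm α) (x : α) : x ∈ cyc w x := mem_cyc.2 (Perm.SameCycle.refl _ _)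

lemma cyc_mem_blocks (w : Perm α) (x : α) : cyc w x ∈ blocks w :=
  mem_image_of_mem _ (mem_univ x)

lemma cyc_eq_iff {w : Perm α} {x y : α} : cyc w x = cyc w y ↔ w.SameCycle x y := by
  constructor
  · intro h
    rw [← mem_cyc, h]
    exact self_mem_cyc w y
  · intro h
    ext z
    simp only [mem_cyc]
    exact ⟨h.symm.trans, h.trans⟩

lemma cyc_inv (w : Perm α) : cyc w⁻¹ = cyc w := by
  ext x y
  simp [mem_cyc, Perm.sameCycle_inv]

lemma blocks_inv (w : Perm α) : blocks w⁻¹ = blocks w := by rw [blocks, cyc_inv, blocks]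

lemma cyc_of_fixed {w : Perm α} {a : α} (h : w a = a) : cyc w a = {a} := by
  ext y
  rw [mem_cyc, mem_singleton]
  exact ⟨fun h' => (h'.eq_of_left h).symm, fun h' => h' ▸ Perm.SameCycle.refl _ _⟩

lemma cyc_subset {w : Perm α} {a : α} {X : Finset α} (ha : a ∈ X) (hX : ∀ x ∈ X, w x ∈ X) :
    cyc w a ⊆ X := by
  intro y hy
  obtain ⟨k, -, -, rfl⟩ := (mem_cyc.1 hy).exists_pow_eq
  induction k with
  | zero => simpa
  | succ k ih =>
    rw [pow_succ', Perm.mul_apply]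
    exact hX _ (ih (mem_cyc.2 ⟨k, by simp⟩))

omit [Fintype α] [DecidableEq α] in
lemma sameCycle_apply (w : Perm α) (x : α) : w.SameCycle x (w x) := ⟨1, by simp⟩

lemma blocks_one : blocks (1 : Perm α) = univ.image singleton := by
  unfold blocks
  congr 1
  ext1 x
  exact cyc_of_fixed rfl

lemma card_blocks_one : #(blocks (1 : Perm α)) = Fintype.card α := by
  rw [blocks_one, card_image_of_injective _ singleton_injective, card_univ]

lemma wt_one {R : Type*} [CommMonoid R] {c : ℕ → R} (hc : c 1 = 1) : wt c (1 : Perm α) = 1 := by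
  rw [wt, blocks_one]
  refine prod_eq_one fun B hB => ?_
  obtain ⟨x, -, rfl⟩ := mem_image.1 hB
  simpa using hc

lemma sameCycle_mul_swap_of_not_sameCycle {w : Perm α} {a b : α} (h : ¬ w.SameCycle a b) :
    (w * swap a b).SameCycle a b := by
  have key : ∀ i : ℕ, (w * swap a b).SameCycle a ((w ^ (i + 1)) b) := by
    intro i
    induction i with
    | zero => exact ⟨1, by simp⟩
    | succ i ih =>
      rw [pow_succ', Perm.mul_apply]
      set y := (w ^ (i + 1)) b with hy
      have hya : y ≠ a := fun e => h (e ▸ Perm.SameCycle.symm ⟨(i + 1 : ℕ), by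
        rw [hy, zpow_natCast]⟩)
      by_cases hyb : y = b
      · rw [hyb]
        exact ⟨1, by simp⟩
      · have := sameCycle_apply (w * swap a b) y
        rw [Perm.mul_apply, swap_apply_of_ne_of_ne hya hyb] at this
        exact ih.trans this
  have hpos := orderOf_pos w
  have := key (orderOf w - 1)
  rwa [Nat.sub_add_cancel hpos, pow_orderOf_eq_one, Perm.one_apply] at this

/-- An enumeration of the cycle of `a`, ending at `a`. -/
lemma exists_enum_cyc (w : Perm α) (a : α) :
    ∃ p : ℕ → α, Set.InjOn p (range #(cyc w a)) ∧ (range #(cyc w a)).image p = cyc w a ∧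
      (∀ k, w (p k) = p (k + 1)) ∧ p 0 = w a ∧ p (#(cyc w a) - 1) = a := by
  set L := Function.minimalPeriod w a with hL
  have hmem : a ∈ Function.periodicPts w :=
    Function.mem_periodicPts.2 ⟨orderOf w, orderOf_pos w, by
      rw [Function.IsPeriodicPt, Function.IsFixedPt, ← Perm.coe_pow, pow_orderOf_eq_one]; rfl⟩
  have hL0 : 0 < L := Function.minimalPeriod_pos_of_mem_periodicPts hmem
  have hL' : Function.minimalPeriod w (w a) = L := Function.minimalPeriod_apply hmem
  have hinj : Set.InjOn (fun k => (w ^ k) (w a)) (range L) := by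
    have := Function.iterate_injOn_Iio_minimalPeriod (f := w) (x := w a)
    rw [hL'] at this
    simpa [← Perm.iterate_eq_pow] using this
  have hend : (w ^ (L - 1)) (w a) = a := by
    rw [← Perm.mul_apply, ← pow_succ, Nat.sub_add_cancel hL0, ← Perm.iterate_eq_pow]
    exact Function.iterate_minimalPeriod
  have hstep : ∀ k, w ((w ^ k) (w a)) = (w ^ (k + 1)) (w a) := fun k => by
    rw [pow_succ', Perm.mul_apply]
  have himg : (range L).image (fun k => (w ^ k) (w a)) = cyc w a := by
    apply Subset.antisymm
    · intro y hy
      obtain ⟨k, -, rfl⟩ := mem_image.1 hy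
      exact mem_cyc.2 ((sameCycle_apply w a).trans ⟨k, by simp⟩)
    · refine cyc_subset (mem_image.2 ⟨L - 1, mem_range.2 (by omega), hend⟩) fun x hx => ?_
      obtain ⟨k, hk, rfl⟩ := mem_image.1 hx
      rw [mem_range] at hk
      by_cases h : k + 1 < L
      · exact mem_image.2 ⟨k + 1, mem_range.2 h, (hstep k).symm⟩
      · refine mem_image.2 ⟨0, mem_range.2 hL0, ?_⟩
        have : k = L - 1 := by omega
        simp [this, hend]
  have hcard : #(cyc w a) = L := by rw [← himg, card_image_of_injOn hinj, card_range]
  rw [hcard]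
  exact ⟨fun k => (w ^ k) (w a), hinj, himg, hstep, by simp, hend⟩

lemma cyc_mul_swap_enum {w : Perm α} {a : α} {p : ℕ → α}
    (hinj : Set.InjOn p (range #(cyc w a))) (himg : (range #(cyc w a)).image p = cyc w a)
    (hstep : ∀ k, w (p k) = p (k + 1)) (h0 : p 0 = w a) (hend : p (#(cyc w a) - 1) = a)
    {i : ℕ} (hi : i + 1 < #(cyc w a)) :
    cyc (w * swap a (p i)) (p i) = (range (i + 1)).image p ∧
      cyc (w * swap a (p i)) a = (Ico (i + 1) #(cyc w a)).image p := by
  set L := #(cyc w a) with hL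
  set v := w * swap a (p i) with hv
  have va : v a = p (i + 1) := by simp [hv, hstep]
  have vp : v (p i) = p 0 := by simp [hv, h0]
  have vk : ∀ k < L, k ≠ i → k ≠ L - 1 → v (p k) = p (k + 1) := by
    intro k hk hki hkL
    rw [hv, Perm.mul_apply, swap_apply_of_ne_of_ne, hstep]
    · intro e
      rw [← hend] at e
      exact hkL (hinj (by simpa using hk) (by simp; omega) e)
    · intro e
      exact hki (hinj (by simpa using hk) (by simp; omega) e)
  have hX : cyc v (p i) ⊆ (range (i + 1)).image p := by
    refine cyc_subset (mem_image_of_mem _ (by simp)) fun x hx => ?_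
    obtain ⟨k, hk, rfl⟩ := mem_image.1 hx
    rw [mem_range] at hk
    by_cases h : k = i
    · rw [h, vp]
      exact mem_image_of_mem _ (by simp)
    · rw [vk k (by omega) h (by omega)]
      exact mem_image_of_mem _ (by simp; omega)
  have hY : cyc v a ⊆ (Ico (i + 1) L).image p := by
    refine cyc_subset (mem_image.2 ⟨L - 1, by simp; omega, hend⟩) fun x hx => ?_
    obtain ⟨k, hk, rfl⟩ := mem_image.1 hx
    rw [mem_Ico] at hk
    by_cases h : k = L - 1
    · rw [h, hend, va]
      exact mem_image_of_mem _ (by simp; omega)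
    · rw [vk k (by omega) (by omega) h]
      exact mem_image_of_mem _ (by simp; omega)
  have hcov : cyc w a ⊆ cyc v (p i) ∪ cyc v a := by
    refine cyc_subset (mem_union_right _ (self_mem_cyc v a)) fun x hx => ?_
    by_cases hxa : x = a
    · refine mem_union_left _ (mem_cyc.2 ?_)
      rw [hxa, ← h0, ← vp]
      exact sameCycle_apply v (p i)
    by_cases hxp : x = p i
    · refine mem_union_right _ (mem_cyc.2 ?_)
      rw [hxp, hstep, ← va]
      exact sameCycle_apply v a
    have hvx : v x = w x := by rw [hv, Perm.mul_apply, swap_apply_of_ne_of_ne hxa hxp]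
    rw [← hvx]
    rw [mem_union, mem_cyc, mem_cyc] at hx ⊢
    exact hx.imp (·.trans (sameCycle_apply v x)) (·.trans (sameCycle_apply v x))
  have hdisj : Disjoint ((range (i + 1)).image p) ((Ico (i + 1) L).image p) := by
    rw [disjoint_left]
    intro x hx hx'
    obtain ⟨k, hk, rfl⟩ := mem_image.1 hx
    obtain ⟨l, hl, e⟩ := mem_image.1 hx'
    rw [mem_range] at hk
    rw [mem_Ico] at hl
    have := hinj (by simp; omega) (by simp; omega) e
    omega
  rw [disjoint_left] at hdisj
  constructor
  · refine hX.antisymm fun x hx => ?_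
    have : x ∈ cyc w a := himg ▸ image_subset_image (range_subset_range.2 (by omega)) hx
    exact (mem_union.1 (hcov this)).resolve_right fun h => hdisj hx (hY h)
  · refine hY.antisymm fun x hx => ?_
    have : x ∈ cyc w a := himg ▸ image_subset_image (fun k => by simp) hx
    exact (mem_union.1 (hcov this)).resolve_left fun h => hdisj (hX h) hx

/-- Multiplying by a transposition of two points of one cycle splits that cycle. -/
lemma cyc_mul_swap {w : Perm α} {a b : α} (h : w.SameCycle a b) (hab : a ≠ b) :
    Disjoint (cyc (w * swap a b) b) (cyc (w * swap a b) a) ∧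
      cyc (w * swap a b) b ∪ cyc (w * swap a b) a = cyc w a := by
  obtain ⟨p, hinj, himg, hstep, h0, hend⟩ := exists_enum_cyc w a
  have hb := mem_cyc.2 h
  rw [← himg] at hb
  obtain ⟨i, hi, rfl⟩ := mem_image.1 hb
  rw [mem_range] at hi
  have hi' : i + 1 < #(cyc w a) := by
    by_contra hc
    exact hab (by rw [← hend]; congr 1; omega)
  obtain ⟨e1, e2⟩ := cyc_mul_swap_enum hinj himg hstep h0 hend hi'
  rw [e1, e2]
  constructor
  · rw [disjoint_left]
    intro x hx hx'
    obtain ⟨k, hk, rfl⟩ := mem_image.1 hx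
    obtain ⟨l, hl, e⟩ := mem_image.1 hx'
    rw [mem_range] at hk
    rw [mem_Ico] at hl
    have := hinj (by simp; omega) (by simp; omega) e
    omega
  · rw [← image_union]
    refine Eq.trans ?_ himg
    congr 1
    ext k
    simp
    omega

lemma cyc_mul_swap_of_not_mem {w : Perm α} {a b x : α} (h : w.SameCycle a b)
    (hx : x ∉ cyc w a) : cyc (w * swap a b) x = cyc w x := by
  have hout : ∀ y, w.SameCycle x y → (w * swap a b) y = w y := by
    intro y hy
    rw [Perm.mul_apply, swap_apply_of_ne_of_ne]
    · rintro rfl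
      exact hx (mem_cyc.2 hy.symm)
    · rintro rfl
      exact hx (mem_cyc.2 (h.trans hy.symm))
  apply Subset.antisymm
  · refine cyc_subset (self_mem_cyc w x) fun y hy => ?_
    rw [mem_cyc] at hy
    rw [hout y hy, mem_cyc]
    exact hy.trans (sameCycle_apply w y)
  · suffices cyc w x ⊆ cyc w x ∩ cyc (w * swap a b) x from this.trans inter_subset_right
    refine cyc_subset (mem_inter.2 ⟨self_mem_cyc _ x, self_mem_cyc _ x⟩) fun y hy => ?_
    rw [mem_inter, mem_cyc, mem_cyc] at hy
    rw [mem_inter, mem_cyc, mem_cyc]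
    refine ⟨hy.1.trans (sameCycle_apply w y), ?_⟩
    rw [← hout y hy.1]
    exact hy.2.trans (sameCycle_apply _ y)

/-- The cycles of `w` other than that of `a`. -/
noncomputable def rest (w : Perm α) (a : α) : Finset (Finset α) := (blocks w).erase (cyc w a)

lemma blocks_eq_insert_rest (w : Perm α) (a : α) : blocks w = insert (cyc w a) (rest w a) :=
  (insert_erase (cyc_mem_blocks w a)).symm

lemma cyc_not_mem_rest (w : Perm α) (a : α) : cyc w a ∉ rest w a := notMem_erase _ _

lemma disjoint_of_mem_rest {w : Perm α} {a : α} {B : Finset α} (hB : B ∈ rest w a) :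
    Disjoint B (cyc w a) := by
  obtain ⟨hne, hB⟩ := mem_erase.1 hB
  obtain ⟨x, -, rfl⟩ := mem_image.1 hB
  rw [disjoint_left]
  intro y hy hy'
  rw [mem_cyc] at hy hy'
  exact hne (cyc_eq_iff.2 (hy.trans hy'.symm))

lemma blocks_mul_swap {w : Perm α} {a b : α} (h : w.SameCycle a b) (hab : a ≠ b) :
    cyc (w * swap a b) b ∉ rest w a ∧
      cyc (w * swap a b) a ∉ insert (cyc (w * swap a b) b) (rest w a) ∧
      blocks (w * swap a b) =
        insert (cyc (w * swap a b) a) (insert (cyc (w * swap a b) b) (rest w a)) := by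
  obtain ⟨hd, hu⟩ := cyc_mul_swap h hab
  set v := w * swap a b with hv
  have hmem : ∀ x ∈ cyc w a, cyc v x ∉ rest w a := by
    intro x hx hc
    have := disjoint_of_mem_rest hc
    exact disjoint_left.1 this (self_mem_cyc v x) hx
  have ha : a ∈ cyc w a := self_mem_cyc w a
  refine ⟨hmem b (mem_cyc.2 h), ?_, ?_⟩
  · rw [mem_insert, not_or]
    refine ⟨fun e => ?_, hmem a ha⟩
    rw [e, disjoint_self_iff_empty] at hd
    exact notMem_empty b (hd ▸ self_mem_cyc v b)
  · ext B
    simp only [mem_insert, rest, mem_erase]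
    constructor
    · intro hB
      obtain ⟨x, -, rfl⟩ := mem_image.1 hB
      by_cases hx : x ∈ cyc w a
      · rw [← hu, mem_union, mem_cyc, mem_cyc, ← cyc_eq_iff, ← cyc_eq_iff] at hx
        rcases hx with hx | hx
        · exact Or.inr (Or.inl hx.symm)
        · exact Or.inl hx.symm
      · rw [hv, cyc_mul_swap_of_not_mem h hx]
        refine Or.inr (Or.inr ⟨fun e => hx ?_, cyc_mem_blocks w x⟩)
        rw [← e]
        exact self_mem_cyc w x
    · rintro (rfl | rfl | ⟨hne, hB⟩)
      · exact cyc_mem_blocks _ _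
      · exact cyc_mem_blocks _ _
      · obtain ⟨x, -, rfl⟩ := mem_image.1 hB
        have hx : x ∉ cyc w a := fun hx => hne (cyc_eq_iff.2 (mem_cyc.1 hx).symm)
        rw [← cyc_mul_swap_of_not_mem h hx]
        exact cyc_mem_blocks _ _

lemma card_blocks_mul_swap {w : Perm α} {a b : α} (h : w.SameCycle a b) (hab : a ≠ b) :
    #(blocks (w * swap a b)) = #(blocks w) + 1 := by
  obtain ⟨h1, h2, h3⟩ := blocks_mul_swap h hab
  rw [h3, card_insert_of_notMem h2, card_insert_of_notMem h1, blocks_eq_insert_rest w a,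
    card_insert_of_notMem (cyc_not_mem_rest w a)]

lemma card_blocks_mul_swap_of_not_sameCycle {w : Perm α} {a b : α} (h : ¬ w.SameCycle a b) :
    #(blocks (w * swap a b)) + 1 = #(blocks w) := by
  have hab : a ≠ b := fun e => h (e ▸ Perm.SameCycle.refl _ _)
  have := card_blocks_mul_swap (sameCycle_mul_swap_of_not_sameCycle h) hab
  rw [mul_assoc, swap_mul_self, mul_one] at this
  exact this.symm

section Weight

variable {R : Type*} [CommMonoid R] (c : ℕ → R)

lemma wt_eq_mul_rest (w : Perm α) (a : α) :
    wt c w = c #(cyc w a) * ∏ B ∈ rest w a, c #B := by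
  rw [wt, blocks_eq_insert_rest w a, prod_insert (cyc_not_mem_rest w a)]

lemma wt_mul_swap {w : Perm α} {a b : α} (h : w.SameCycle a b) (hab : a ≠ b) :
    wt c (w * swap a b) = c #(cyc (w * swap a b) a) * (c #(cyc (w * swap a b) b) *
      ∏ B ∈ rest w a, c #B) := by
  obtain ⟨h1, h2, h3⟩ := blocks_mul_swap h hab
  rw [wt, h3, prod_insert h2, prod_insert h1]

end Weight

/-- Summing over the ways of splitting the cycle of `a`. -/
lemma sum_cyc_mul_swap {R : Type*} [AddCommMonoid R] (g : ℕ → ℕ → R) (w : Perm α) (a : α) :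
    ∑ b ∈ (cyc w a).erase a, g #(cyc (w * swap a b) a) #(cyc (w * swap a b) b) =
      ∑ i ∈ range (#(cyc w a) - 1), g (#(cyc w a) - (i + 1)) (i + 1) := by
  obtain ⟨p, hinj, himg, hstep, h0, hend⟩ := exists_enum_cyc w a
  symm
  refine sum_bij (fun i _ => p i) ?_ ?_ ?_ ?_
  · intro i hi
    rw [mem_range] at hi
    have hi' : p i ∈ (range #(cyc w a)).image p := mem_image_of_mem _ (by simp; omega)
    rw [himg] at hi'
    refine mem_erase.2 ⟨fun e => ?_, hi'⟩
    rw [← hend] at e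
    have := hinj (by simp; omega) (by rw [mem_coe, mem_range]; omega) e
    omega
  · intro i hi j hj e
    rw [mem_range] at hi hj
    exact hinj (by simp; omega) (by simp; omega) e
  · intro b hb
    obtain ⟨hne, hb⟩ := mem_erase.1 hb
    rw [← himg] at hb
    obtain ⟨i, hi, rfl⟩ := mem_image.1 hb
    rw [mem_range] at hi
    refine ⟨i, mem_range.2 ?_, rfl⟩
    by_contra hc
    have e : i = #(cyc w a) - 1 := by omega
    exact hne (by rw [e, hend])
  · intro i hi
    rw [mem_range] at hi
    obtain ⟨e1, e2⟩ := cyc_mul_swap_enum hinj himg hstep h0 hend (i := i) (by omega)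
    rw [e1, e2, card_image_of_injOn (hinj.mono _), card_image_of_injOn (hinj.mono _)]
    · simp
    · intro k hk
      simp at hk ⊢
      omega
    · intro k hk
      simp at hk ⊢
      omega

/-- The Möbius function of the noncrossing partition lattice of a cycle of length `L`. -/
def cycMoebius (L : ℕ) : ℤ := (-1) ^ (L - 1) * catalan (L - 1)

lemma cycMoebius_one : cycMoebius 1 = 1 := by simp [cycMoebius]

lemma cycMoebius_add_sum {L : ℕ} (hL : 2 ≤ L) :
    cycMoebius L + ∑ i ∈ range (L - 1), cycMoebius (L - (i + 1)) * cycMoebius (i + 1) = 0 := by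
  obtain ⟨m, rfl⟩ := Nat.exists_eq_add_of_le' hL
  have : ∀ i ∈ range (m + 2 - 1), cycMoebius (m + 2 - (i + 1)) * cycMoebius (i + 1)
      = (-1) ^ m * (catalan i * catalan (m - i) : ℕ) := by
    intro i hi
    rw [mem_range] at hi
    have e : m + 2 - (i + 1) - 1 = m - i := by omega
    have e' : (-1 : ℤ) ^ m = (-1) ^ (m - i) * (-1) ^ i := by
      rw [← pow_add]
      congr 1
      omega
    rw [cycMoebius, cycMoebius, e, e', Nat.add_sub_cancel]
    push_cast
    ring
  rw [sum_congr rfl this, ← mul_sum, ← Nat.cast_sum, cycMoebius]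
  have hc : catalan (m + 2 - 1) = ∑ i ∈ range (m + 2 - 1), catalan i * catalan (m - i) := by
    rw [show m + 2 - 1 = m + 1 by omega, catalan_succ,
      Fin.sum_univ_eq_sum_range (fun i => catalan i * catalan (m - i))]
  rw [← hc, show m + 2 - 1 = m + 1 by omega]
  ring

lemma sum_wt_mul_swap {w : Perm α} {a : α} (ha : w a ≠ a) :
    ∑ b ∈ cyc w a, wt cycMoebius (w * swap a b) = 0 := by
  rw [← insert_erase (self_mem_cyc w a), sum_insert (notMem_erase _ _), swap_self]
  have hL : 2 ≤ #(cyc w a) := by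
    refine one_lt_card.2 ⟨a, self_mem_cyc w a, w a, mem_cyc.2 (sameCycle_apply w a), ha.symm⟩
  have : ∀ b ∈ (cyc w a).erase a, wt cycMoebius (w * swap a b) =
      cycMoebius #(cyc (w * swap a b) a) * cycMoebius #(cyc (w * swap a b) b) *
        ∏ B ∈ rest w a, cycMoebius #B := by
    intro b hb
    obtain ⟨hne, hb⟩ := mem_erase.1 hb
    rw [wt_mul_swap _ (mem_cyc.1 hb) hne.symm, mul_assoc]
  rw [sum_congr rfl this, ← sum_mul,
    sum_cyc_mul_swap (fun x y => cycMoebius x * cycMoebius y)]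
  have hw : w * Equiv.refl α = w := mul_one w
  rw [hw, wt_eq_mul_rest _ w a, ← add_mul, cycMoebius_add_sum hL, zero_mul]

end Cycles

section ReflectionLength

variable {n : ℕ}

lemma exists_isSwap_list (w : Perm (Fin n)) :
    ∃ l : List (Perm (Fin n)), (∀ t ∈ l, t.IsSwap) ∧ l.prod = w ∧
      l.length + #(blocks w) = n := by
  have hle : ∀ w : Perm (Fin n), #(blocks w) ≤ n := fun w =>
    card_image_le.trans (by simp)
  induction hk : n - #(blocks w) generalizing w with
  | zero =>
    have hw : w = 1 := by
      by_contra hne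
      obtain ⟨a, ha⟩ := Perm.ext_iff.not.trans not_forall |>.1 hne
      have := card_blocks_mul_swap (sameCycle_apply w a) (Ne.symm ha)
      have := hle (w * swap a (w a))
      omega
    exact ⟨[], by simp, by simp [hw], by simp [hw, card_blocks_one]⟩
  | succ k ih =>
    have hne : w ≠ 1 := by
      rintro rfl
      simp [card_blocks_one] at hk
    obtain ⟨a, ha⟩ := Perm.ext_iff.not.trans not_forall |>.1 hne
    have h1 := card_blocks_mul_swap (sameCycle_apply w a) (Ne.symm ha)
    have h2 := hle (w * swap a (w a))
    obtain ⟨l, hl, hp, hn⟩ := ih (w * swap a (w a)) (by omega)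
    refine ⟨l ++ [swap a (w a)], ?_, by rw [List.prod_append, hp]; simp [mul_assoc], ?_⟩
    · intro t ht
      rcases List.mem_append.1 ht with ht | ht
      · exact hl t ht
      · rw [List.mem_singleton.1 ht]
        exact ⟨a, w a, Ne.symm ha, rfl⟩
    · simp
      omega

lemma le_length_add_card_blocks (l : List (Perm (Fin n))) (hl : ∀ t ∈ l, t.IsSwap) :
    n ≤ l.length + #(blocks l.prod) := by
  induction l using List.reverseRecOn with
  | nil => simp [card_blocks_one]
  | append_singleton l t ih =>
    have := ih fun s hs => hl s (by simp [hs])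
    obtain ⟨a, b, hab, rfl⟩ := hl t (by simp)
    rw [List.prod_append, List.prod_singleton, List.length_append, List.length_singleton]
    by_cases h : l.prod.SameCycle a b
    · have := card_blocks_mul_swap h hab
      omega
    · have := card_blocks_mul_swap_of_not_sameCycle h
      omega

lemma reflLen_add_card_blocks (w : Perm (Fin n)) : reflLen w + #(blocks w) = n := by
  obtain ⟨l, hl, hp, hn⟩ := exists_isSwap_list w
  have hmem : l.length ∈ {k | ∃ l : List (Perm (Fin n)), l.length = k ∧
    (∀ t ∈ l, t.IsSwap) ∧ l.prod = w} := ⟨l, rfl, hl, hp⟩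
  have h1 : reflLen w ≤ l.length := Nat.sInf_le hmem
  obtain ⟨l', hlen, hl', hp'⟩ := Nat.sInf_mem ⟨_, hmem⟩
  have h2 := le_length_add_card_blocks l' hl'
  rw [hlen, hp'] at h2
  change n ≤ reflLen w + _ at h2
  omega

lemma reflLen_one : reflLen (1 : Perm (Fin n)) = 0 := by
  have := reflLen_add_card_blocks (1 : Perm (Fin n))
  rw [card_blocks_one, Fintype.card_fin] at this
  omega

lemma reflLen_inv (w : Perm (Fin n)) : reflLen w⁻¹ = reflLen w := by
  have h1 := reflLen_add_card_blocks w
  have h2 := reflLen_add_card_blocks w⁻¹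
  rw [blocks_inv] at h2
  omega

lemma reflLen_mul_swap_of_sameCycle {w : Perm (Fin n)} {a b : Fin n} (h : w.SameCycle a b)
    (hab : a ≠ b) : reflLen (w * swap a b) + 1 = reflLen w := by
  have := reflLen_add_card_blocks w
  have := reflLen_add_card_blocks (w * swap a b)
  have := card_blocks_mul_swap h hab
  omega

lemma reflLen_mul_swap_of_not_sameCycle {w : Perm (Fin n)} {a b : Fin n}
    (h : ¬ w.SameCycle a b) : reflLen (w * swap a b) = reflLen w + 1 := by
  have := reflLen_add_card_blocks w
  have := reflLen_add_card_blocks (w * swap a b)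
  have := card_blocks_mul_swap_of_not_sameCycle h
  omega

lemma reflLen_swap_mul_of_fixed {w : Perm (Fin n)} {a b : Fin n} (h : w a = a) (hab : a ≠ b) :
    reflLen (swap a b * w) = reflLen w + 1 := by
  rw [← reflLen_inv, mul_inv_rev, swap_inv, reflLen_mul_swap_of_not_sameCycle, reflLen_inv]
  rw [Perm.sameCycle_inv]
  exact fun hc => hab (hc.eq_of_left h)

lemma reflLen_pos {w : Perm (Fin n)} (h : w ≠ 1) : 0 < reflLen w := by
  obtain ⟨a, ha⟩ := Perm.ext_iff.not.trans not_forall |>.1 h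
  have := reflLen_mul_swap_of_sameCycle (sameCycle_apply w a) (Ne.symm ha)
  omega

lemma reflLen_mul_le (u v : Perm (Fin n)) : reflLen (u * v) ≤ reflLen u + reflLen v := by
  obtain ⟨l, hl, hp, hn⟩ := exists_isSwap_list u
  obtain ⟨l', hl', hp', hn'⟩ := exists_isSwap_list v
  have h1 := reflLen_add_card_blocks u
  have h2 := reflLen_add_card_blocks v
  have h3 := reflLen_add_card_blocks (u * v)
  have h4 := le_length_add_card_blocks (l ++ l') fun t ht =>
    (List.mem_append.1 ht).elim (hl t) (hl' t)
  rw [List.prod_append, hp, hp', List.length_append] at h4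
  omega

/-- Permutations are products of one with a prescribed value at `a` and a transposition. -/
lemma sum_perm_eq_sum_mul_swap {α R : Type*} [Fintype α] [DecidableEq α] [AddCommMonoid R]
    (g : Perm α → R) (a c : α) :
    ∑ y, g y = ∑ x with x a = c, ∑ b, g (x * swap a b) := by
  rw [sum_sigma']
  refine sum_bij' (fun y _ => ⟨y * swap a (y⁻¹ c), y⁻¹ c⟩) (fun p _ => p.1 * swap a p.2)
    ?_ ?_ ?_ ?_ ?_
  · intro y _
    simp
  · simp
  · intro y _
    simp [mul_assoc]
  · rintro ⟨x, b⟩ hx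
    simp only [mem_sigma, mem_filter, mem_univ, true_and, and_true] at hx
    have : (x * swap a b)⁻¹ c = b := by
      rw [Perm.inv_eq_iff_eq]
      simp [hx]
    simp only [this]
    simp [mul_assoc]
  · intro y _
    simp [mul_assoc]

lemma absLe_mul_swap_iff {x z : Perm (Fin n)} {a b : Fin n} (hx : x a = z a) :
    AbsLe (x * swap a b) z ↔ AbsLe x z ∧ x.SameCycle a b := by
  have hfix : (x⁻¹ * z) a = a := by simp [← hx]
  have hle : reflLen z ≤ reflLen x + reflLen (x⁻¹ * z) := by
    simpa using reflLen_mul_le x (x⁻¹ * z)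
  by_cases hab : a = b
  · subst hab
    have hw : x * Equiv.refl (Fin n) = x := mul_one x
    rw [swap_self, hw]
    exact ⟨fun h => ⟨h, Perm.SameCycle.refl _ _⟩, fun h => h.1⟩
  have h1 := reflLen_swap_mul_of_fixed hfix hab
  unfold AbsLe
  rw [mul_inv_rev, swap_inv, mul_assoc, h1]
  by_cases h : x.SameCycle a b
  · have := reflLen_mul_swap_of_sameCycle h hab
    simp only [h, and_true]
    omega
  · have := reflLen_mul_swap_of_not_sameCycle h
    simp only [h, and_false, iff_false]
    omega

lemma sum_absLe_wt {z : Perm (Fin n)} (hz : z ≠ 1) :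
    (∑ y : Perm (Fin n), if AbsLe y z then wt cycMoebius y else 0) = 0 := by
  obtain ⟨a, ha⟩ := Perm.ext_iff.not.trans not_forall |>.1 hz
  rw [sum_perm_eq_sum_mul_swap _ a (z a)]
  refine sum_eq_zero fun x hx => ?_
  have hx : x a = z a := (mem_filter.1 hx).2
  by_cases h : AbsLe x z
  · have := sum_wt_mul_swap (w := x) (a := a) (by rwa [hx])
    rw [cyc, sum_filter] at this
    simpa only [absLe_mul_swap_iff hx, h, true_and] using this
  · simp [absLe_mul_swap_iff hx, h]

lemma moebius_eq_wt {μ : Perm (Fin n) → ℤ} (h1 : μ 1 = 1)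
    (hμ : ∀ z : Perm (Fin n), z ≠ 1 → (∑ y, if AbsLe y z then μ y else 0) = 0)
    (z : Perm (Fin n)) : μ z = wt cycMoebius z := by
  induction hk : reflLen z using Nat.strong_induction_on generalizing z with
  | _ k ih =>
    by_cases hz : z = 1
    · rw [hz, h1, wt_one cycMoebius_one]
    have hlt : ∀ y ∈ univ.erase z, (if AbsLe y z then μ y else 0)
        = if AbsLe y z then wt cycMoebius y else 0 := by
      intro y hy
      split_ifs with hle
      · have : 0 < reflLen (y⁻¹ * z) := reflLen_pos fun e =>
          (mem_erase.1 hy).1 (inv_mul_eq_one.1 e)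
        unfold AbsLe at hle
        exact ih (reflLen y) (by omega) y rfl
      · rfl
    have hzz : AbsLe z z := by simp [AbsLe, reflLen_one]
    have e1 := hμ z hz
    have e2 := sum_absLe_wt hz
    rw [← add_sum_erase _ _ (mem_univ z), if_pos hzz] at e1 e2
    rw [sum_congr rfl hlt] at e1
    linarith

end ReflectionLength

section CycleSum

variable {α R : Type*} [Fintype α] [DecidableEq α] [CommSemiring R]

/-- The permutations fixing every point outside `S`. -/
noncomputable def fixOut (S : Finset α) : Finset (Perm α) := univ.filter fun w => ∀ x ∉ S, w x = x

lemma mem_fixOut {S : Finset α} {w : Perm α} : w ∈ fixOut S ↔ ∀ x ∉ S, w x = x := by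
  simp [fixOut]

/-- The sum of the weights of the permutations of `S`, the length of the cycle of `a` being counted
with an excess `k`. -/
noncomputable def markedSum (c : ℕ → R) (k : ℕ) (S : Finset α) (a : α) : R :=
  ∑ w ∈ fixOut S, c (#(cyc w a) + k) * ∏ B ∈ rest w a, c #B

lemma sum_fixOut {M : Type*} [AddCommMonoid M] (g : Perm α → M) {S : Finset α} {a : α}
    (ha : a ∈ S) :
    ∑ w ∈ fixOut S, g w = ∑ x ∈ fixOut (S.erase a), ∑ b ∈ S, g (x * swap a b) := by
  have hiff : ∀ x : Perm α, x a = a → ∀ b,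
      (x * swap a b ∈ fixOut S ↔ x ∈ fixOut (S.erase a) ∧ b ∈ S) := by
    intro x hx b
    rw [mem_fixOut, mem_fixOut]
    constructor
    · intro h
      have hb : b ∈ S := by
        by_contra hb
        have := h b hb
        rw [Perm.mul_apply, swap_apply_right, hx] at this
        exact hb (this ▸ ha)
      refine ⟨fun y hy => ?_, hb⟩
      by_cases hya : y = a
      · rw [hya, hx]
      have hyS : y ∉ S := fun h' => hy (mem_erase.2 ⟨hya, h'⟩)
      have := h y hyS
      rwa [Perm.mul_apply, swap_apply_of_ne_of_ne hya fun e => hyS (e ▸ hb)] at this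
    · rintro ⟨h, hb⟩ y hy
      have hya : y ≠ a := fun e => hy (e ▸ ha)
      have hyb : y ≠ b := fun e => hy (e ▸ hb)
      rw [Perm.mul_apply, swap_apply_of_ne_of_ne hya hyb]
      exact h y fun h' => hy (mem_of_mem_erase h')
  have hsub : fixOut (S.erase a) ⊆ univ.filter fun x : Perm α => x a = a := fun x hx =>
    mem_filter.2 ⟨mem_univ x, mem_fixOut.1 hx a (by simp)⟩
  have h1 : ∑ w ∈ fixOut S, g w = ∑ w, if w ∈ fixOut S then g w else 0 := by
    rw [← sum_filter, filter_mem_eq_inter, univ_inter]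
  rw [h1, sum_perm_eq_sum_mul_swap _ a a, ← sum_subset hsub]
  · refine sum_congr rfl fun x hx => ?_
    have hxa := (mem_filter.1 (hsub hx)).2
    simp only [hiff x hxa, hx, true_and]
    rw [← sum_filter, filter_mem_eq_inter, univ_inter]
  · intro x hx hx'
    refine sum_eq_zero fun b _ => if_neg fun h => hx' ((hiff x (mem_filter.1 hx).2 b).1 h).1

lemma markedSum_eq {c : ℕ → R} (hc : c 1 = 1) (k : ℕ) {S : Finset α} {a : α} (ha : a ∈ S) :
    markedSum c k S a = c (k + 1) * ∑ w ∈ fixOut (S.erase a), wt c w +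
      ∑ i ∈ S.erase a, markedSum c (k + 1) (S.erase a) i := by
  unfold markedSum
  rw [sum_fixOut _ ha, sum_comm (s := S.erase a), mul_sum, ← sum_add_distrib]
  refine sum_congr rfl fun x hx => ?_
  have hxa : x a = a := mem_fixOut.1 hx a (by simp)
  rw [← add_sum_erase _ _ ha]
  congr 1
  · have hw : x * Equiv.refl α = x := mul_one x
    rw [swap_self, hw, wt_eq_mul_rest c x a, cyc_of_fixed hxa, card_singleton, hc, one_mul,
      add_comm]
  · refine sum_congr rfl fun b hb => ?_
    have hba : a ≠ b := (ne_of_mem_erase hb).symm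
    have hnot : ¬ x.SameCycle a b := fun h => hba (h.eq_of_left hxa)
    have hs := sameCycle_mul_swap_of_not_sameCycle hnot
    set w := x * swap a b with hw
    have hx' : w * swap a b = x := by rw [hw, mul_assoc, swap_mul_self, mul_one]
    obtain ⟨h1, h2, h3⟩ := blocks_mul_swap hs hba
    obtain ⟨hd, hu⟩ := cyc_mul_swap hs hba
    rw [hx'] at h1 h2 h3 hd hu
    have hcard : #(cyc w a) = #(cyc x b) + 1 := by
      rw [← hu, card_union_of_disjoint hd, cyc_of_fixed hxa, card_singleton]
    rw [mem_insert, not_or] at h2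
    have hrest : rest x b = insert (cyc x a) (rest w a) := by
      rw [rest, h3, insert_comm, erase_insert]
      rw [mem_insert, not_or]
      exact ⟨fun e => h2.1 e.symm, h1⟩
    rw [hrest, prod_insert h2.2, hcard, cyc_of_fixed hxa, card_singleton, hc, one_mul, add_assoc,
      add_comm 1 k]

/-- The value of `markedSum` on a set with `n` elements. -/
def markedCount (c : ℕ → R) : ℕ → ℕ → R
  | 0, _ => 1
  | n + 1, k => c (k + 1) * markedCount c n 0 + n * markedCount c n (k + 1)

lemma sum_fixOut_wt {c : ℕ → R} (hc : c 1 = 1) (n : ℕ) (S : Finset α) (hS : #S = n) :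
    ∑ w ∈ fixOut S, wt c w = markedCount c n 0 ∧
      ∀ k, ∀ a ∈ S, markedSum c k S a = markedCount c n k := by
  induction n generalizing S with
  | zero =>
    obtain rfl := card_eq_zero.1 hS
    have : fixOut (∅ : Finset α) = {1} := by
      ext w
      simp [mem_fixOut, Perm.ext_iff]
    simp [this, wt_one hc, markedCount]
  | succ n ih =>
    have hmarked : ∀ k, ∀ a ∈ S, markedSum c k S a = markedCount c (n + 1) k := by
      intro k a ha
      have hcard : #(S.erase a) = n := by rw [card_erase_of_mem ha, hS]; rfl
      obtain ⟨h1, h2⟩ := ih _ hcard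
      rw [markedSum_eq hc k ha, h1, sum_congr rfl (h2 (k + 1)), sum_const, hcard, nsmul_eq_mul,
        markedCount]
    refine ⟨?_, hmarked⟩
    obtain ⟨a, ha⟩ : S.Nonempty := card_pos.1 (by omega)
    rw [← hmarked 0 a ha]
    exact sum_congr rfl fun w _ => wt_eq_mul_rest c w a

lemma sum_wt {c : ℕ → R} (hc : c 1 = 1) :
    ∑ w : Perm α, wt c w = markedCount c (Fintype.card α) 0 := by
  rw [← (sum_fixOut_wt hc _ (univ : Finset α) card_univ).1]
  refine sum_congr ?_ fun _ _ => rfl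
  ext w
  simp [mem_fixOut]

lemma markedCount_succ (c : ℕ → R) (n k : ℕ) :
    markedCount c (n + 1) k =
      ∑ j ∈ range (n + 1), n.descFactorial j * c (k + j + 1) * markedCount c (n - j) 0 := by
  induction n generalizing k with
  | zero => simp [markedCount]
  | succ n ih =>
    rw [markedCount, ih (k + 1), sum_range_succ' _ (n + 1), add_comm, mul_sum]
    congr 1
    · refine sum_congr rfl fun j _ => ?_
      rw [Nat.succ_descFactorial_succ, Nat.add_sub_add_right, show k + 1 + j = k + (j + 1) by ring]
      push_cast
      ring
    · simp

end CycleSum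

/-- The coefficients of the exponential generating function of the sums over `S_n` of the Möbius
function, with alternating signs. -/
noncomputable def egfCoeff (n : ℕ) : ℝ := (-1) ^ n * (markedCount cycMoebius n 0 : ℤ) / n.factorial

lemma egfCoeff_zero : egfCoeff 0 = 1 := by simp [egfCoeff, markedCount]

lemma egfCoeff_succ (n : ℕ) :
    (n + 1) * egfCoeff (n + 1) = -∑ j ∈ range (n + 1), catalan j * egfCoeff (n - j) := by
  have hn : ((n + 1 : ℕ) : ℝ) ≠ 0 := by positivity
  have hf : (n.factorial : ℝ) ≠ 0 := by positivity
  unfold egfCoeff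
  rw [markedCount_succ, Nat.factorial_succ]
  push_cast at hn ⊢
  rw [mul_sum, sum_div, mul_sum, ← sum_neg_distrib]
  refine sum_congr rfl fun j hj => ?_
  rw [mem_range, Nat.lt_succ_iff] at hj
  have hd : ((n - j).factorial : ℝ) * n.descFactorial j = n.factorial := by
    exact_mod_cast Nat.factorial_mul_descFactorial hj
  have hf' : ((n - j).factorial : ℝ) ≠ 0 := by positivity
  have hs : (-1 : ℝ) ^ (n + 1) * (-1) ^ j = -(-1) ^ (n - j) := by
    have : (-1 : ℝ) ^ n = (-1) ^ (n - j) * (-1) ^ j := by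
      rw [← pow_add, Nat.sub_add_cancel hj]
    have h2 : (-1 : ℝ) ^ j * (-1) ^ j = 1 := by rw [← mul_pow]; simp
    rw [pow_succ, this]
    linear_combination (-(-1 : ℝ) ^ (n - j)) * h2
  rw [← hd] at hf ⊢
  have hd' := right_ne_zero_of_mul hf
  simp only [cycMoebius, zero_add, Nat.add_sub_cancel]
  push_cast
  field_simp
  linear_combination (catalan j : ℝ) * (markedCount cycMoebius (n - j) 0 : ℤ) * hs

section Analysis

lemma catalan_le (n : ℕ) : |(catalan n : ℝ)| ≤ 4 ^ n := by
  have h1 : catalan n ≤ 4 ^ n := by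
    rw [catalan_eq_centralBinom_div]
    refine (Nat.div_le_self _ _).trans ((Nat.choose_le_two_pow _ _).trans ?_)
    rw [pow_mul]
    norm_num
  rw [abs_of_nonneg (by positivity)]
  exact_mod_cast h1

lemma egfCoeff_le (n : ℕ) : |egfCoeff n| ≤ 4 ^ n := by
  induction n using Nat.strong_induction_on with
  | _ n ih =>
    cases n with
    | zero => simp [egfCoeff_zero]
    | succ n =>
      have h : ((n : ℝ) + 1) * |egfCoeff (n + 1)| ≤ (n + 1) * 4 ^ n := by
        have h0 : |((n : ℝ) + 1) * egfCoeff (n + 1)| = (n + 1) * |egfCoeff (n + 1)| := by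
          rw [abs_mul, abs_of_nonneg (by positivity)]
        rw [← h0, egfCoeff_succ, abs_neg]
        refine (abs_sum_le_sum_abs _ _).trans ?_
        have : ∀ j ∈ range (n + 1), |(catalan j : ℝ) * egfCoeff (n - j)| ≤ 4 ^ n := by
          intro j hj
          rw [mem_range, Nat.lt_succ_iff] at hj
          rw [abs_mul]
          calc _ ≤ (4 : ℝ) ^ j * 4 ^ (n - j) :=
                mul_le_mul (catalan_le j) (ih _ (by omega)) (abs_nonneg _) (by positivity)
            _ = 4 ^ n := by rw [← pow_add, Nat.add_sub_cancel' hj]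
        refine (sum_le_sum this).trans (by simp)
      have h' := le_of_mul_le_mul_left h (by positivity)
      exact h'.trans (pow_le_pow_right₀ (by norm_num) (by omega))

variable {a : ℕ → ℝ} {t : ℝ}

lemma norm_term_le (ha : ∀ n, |a n| ≤ 4 ^ n) (ht : |t| < 1 / 16) (n : ℕ) :
    ‖a n * t ^ n‖ ≤ (1 / 4) ^ n := by
  rw [norm_mul, norm_pow, Real.norm_eq_abs, Real.norm_eq_abs]
  calc _ ≤ (4 : ℝ) ^ n * (1 / 16) ^ n := by
        gcongr
        exact ha n
    _ = _ := by rw [← mul_pow]; norm_num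

lemma summable_norm_term (ha : ∀ n, |a n| ≤ 4 ^ n) (ht : |t| < 1 / 16) :
    Summable fun n => ‖a n * t ^ n‖ :=
  Summable.of_nonneg_of_le (fun _ => norm_nonneg _) (norm_term_le ha ht)
    (summable_geometric_of_lt_one (by norm_num) (by norm_num))

lemma tsum_eq_zero_add_term (ha : ∀ n, |a n| ≤ 4 ^ n) (ht : |t| < 1 / 16) :
    ∑' n, a n * t ^ n = a 0 + t * ∑' n, a (n + 1) * t ^ n := by
  rw [(summable_norm_term ha ht).of_norm.tsum_eq_zero_add, ← tsum_mul_left]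
  simp only [pow_zero, mul_one]
  congr 2
  ext n
  ring

lemma hasDerivAt_tsum_term (ha : ∀ n, |a n| ≤ 4 ^ n) (ht : |t| < 1 / 16) :
    HasDerivAt (fun s => ∑' n, a n * s ^ n) (∑' n : ℕ, (n + 1) * a (n + 1) * t ^ n) t := by
  have hu : Summable fun n : ℕ => 16 * ((n : ℝ) ^ 1 * (1 / 4) ^ n) :=
    (summable_pow_mul_geometric_of_norm_lt_one (R := ℝ) 1 (r := 1 / 4) (by norm_num)).mul_left 16
  have hbd : ∀ (n : ℕ) (y : ℝ), y ∈ Metric.ball (0 : ℝ) (1 / 16) →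
      ‖a n * (n * y ^ (n - 1))‖ ≤ 16 * ((n : ℝ) ^ 1 * (1 / 4) ^ n) := by
    intro n y hy
    rw [mem_ball_zero_iff] at hy
    cases n with
    | zero => simp
    | succ n =>
      rw [norm_mul, norm_mul, norm_pow, Nat.add_sub_cancel, RCLike.norm_natCast, pow_one]
      calc _ ≤ (4 : ℝ) ^ (n + 1) * (((n + 1 : ℕ) : ℝ) * (1 / 16) ^ n) := by
            gcongr
            exact ha _
        _ = 16 * (((n + 1 : ℕ) : ℝ) * ((4 : ℝ) ^ (n + 1) * (1 / 16) ^ (n + 1))) := by ring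
        _ = _ := by rw [← mul_pow]; norm_num
  have htb : t ∈ Metric.ball (0 : ℝ) (1 / 16) := by rwa [mem_ball_zero_iff]
  have key := hasDerivAt_tsum_of_isPreconnected hu Metric.isOpen_ball
    (convex_ball (0 : ℝ) (1 / 16)).isPreconnected
    (fun n y _ => (hasDerivAt_pow n y).const_mul (a n)) hbd htb
    (summable_norm_term ha ht).of_norm htb
  refine key.congr_deriv ?_
  rw [(Summable.of_norm_bounded hu fun n => hbd n t htb).tsum_eq_zero_add]
  simp only [CharP.cast_eq_zero, zero_mul, mul_zero, zero_add, Nat.add_sub_cancel]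
  congr 1
  ext n
  push_cast
  ring

/-- The Catalan power series. -/
noncomputable def catSeries (t : ℝ) : ℝ := ∑' n, (catalan n : ℝ) * t ^ n

/-- The power series with coefficients `egfCoeff`. -/
noncomputable def egfSeries (t : ℝ) : ℝ := ∑' n, egfCoeff n * t ^ n

lemma tsum_mul_tsum_term {b : ℕ → ℝ} (ha : ∀ n, |a n| ≤ 4 ^ n) (hb : ∀ n, |b n| ≤ 4 ^ n)
    (ht : |t| < 1 / 16) :
    (∑' n, a n * t ^ n) * ∑' n, b n * t ^ n =
      ∑' n, (∑ j ∈ range (n + 1), a j * b (n - j)) * t ^ n := by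
  rw [tsum_mul_tsum_eq_tsum_sum_range_of_summable_norm (summable_norm_term ha ht)
    (summable_norm_term hb ht)]
  congr 1
  ext n
  rw [sum_mul]
  refine sum_congr rfl fun j hj => ?_
  rw [mem_range, Nat.lt_succ_iff] at hj
  rw [← pow_sub_mul_pow t hj]
  ring

lemma catSeries_eq (ht : |t| < 1 / 16) : catSeries t = 1 + t * (catSeries t * catSeries t) := by
  unfold catSeries
  rw [tsum_mul_tsum_term catalan_le catalan_le ht, tsum_eq_zero_add_term catalan_le ht]
  congr 3
  · simp
  · ext n
    rw [catalan_succ, ← Fin.sum_univ_eq_sum_range (fun j => (catalan j : ℝ) * catalan (n - j))]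
    push_cast
    rfl

lemma catSeries_ne_zero (ht : |t| < 1 / 16) : catSeries t ≠ 0 := fun h => by
  have := catSeries_eq ht
  simp [h] at this

lemma catGF_eq (ht : |t| < 1 / 16) (h0 : t ≠ 0) : catGF t = catSeries t := by
  have hb : |catSeries t| ≤ 4 / 3 := by
    refine (tsum_of_norm_bounded (hasSum_geometric_of_lt_one (r := 1 / 4) (by norm_num)
      (by norm_num)) (norm_term_le catalan_le ht)).trans (by norm_num)
  have hprod : |t * catSeries t| ≤ 1 / 16 * (4 / 3) := by
    rw [abs_mul]
    gcongr
  have hpos : 0 ≤ 1 - 2 * (t * catSeries t) := by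
    have := (abs_le.1 hprod).2
    linarith
  have hsq : 1 - 4 * t = (1 - 2 * (t * catSeries t)) ^ 2 := by
    linear_combination (4 * t) * catSeries_eq ht
  rw [catGF, hsq, Real.sqrt_sq hpos]
  field_simp
  ring

lemma hasDerivAt_egfSeries (ht : |t| < 1 / 16) :
    HasDerivAt egfSeries (-(catSeries t * egfSeries t)) t := by
  refine (hasDerivAt_tsum_term egfCoeff_le ht).congr_deriv ?_
  unfold catSeries egfSeries
  rw [tsum_mul_tsum_term catalan_le egfCoeff_le ht, ← tsum_neg]
  congr 1
  ext n
  rw [egfCoeff_succ, neg_mul]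

lemma egfSeries_eq (ht : |t| < 1 / 16) :
    egfSeries t = catSeries t * Real.exp (-2 * t * catSeries t) := by
  set h : ℝ → ℝ := fun s => egfSeries s * Real.exp (2 * s * catSeries s) / catSeries s with hh
  have hder : ∀ s ∈ Metric.ball (0 : ℝ) (1 / 16), HasDerivAt h 0 s := by
    intro s hs
    rw [mem_ball_zero_iff, Real.norm_eq_abs] at hs
    obtain ⟨d, hd⟩ : ∃ d, HasDerivAt catSeries d s := ⟨_, hasDerivAt_tsum_term catalan_le hs⟩
    have hd' : d = catSeries s * catSeries s + s * (d * catSeries s + catSeries s * d) := by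
      have h1 : HasDerivAt (fun x => 1 + x * (catSeries x * catSeries x))
          (1 * (catSeries s * catSeries s) + s * (d * catSeries s + catSeries s * d)) s :=
        ((hasDerivAt_id s).mul (hd.mul hd)).const_add 1
      have h2 : catSeries =ᶠ[nhds s] fun x => 1 + x * (catSeries x * catSeries x) := by
        filter_upwards [Metric.isOpen_ball.mem_nhds (show s ∈ Metric.ball (0 : ℝ) (1 / 16) by
          rwa [mem_ball_zero_iff])] with x hx
        rw [mem_ball_zero_iff, Real.norm_eq_abs] at hx
        exact catSeries_eq hx
      rw [← one_mul (catSeries s * catSeries s)]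
      exact hd.unique (h1.congr_of_eventuallyEq h2)
    have hlin : HasDerivAt (fun x => 2 * x * catSeries x) (2 * 1 * catSeries s + 2 * s * d) s :=
      ((hasDerivAt_id s).const_mul 2).mul hd
    have hne := catSeries_ne_zero hs
    refine (((hasDerivAt_egfSeries hs).mul hlin.exp).div hd hne).congr_deriv ?_
    simp only [Pi.mul_apply]
    generalize Real.exp (2 * s * catSeries s) = E
    field_simp
    linear_combination (-(egfSeries s * E)) * hd'
  have hconst : h t = h 0 := by
    refine Metric.isOpen_ball.is_const_of_deriv_eq_zero (convex_ball _ _).isPreconnected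
      (fun s hs => (hder s hs).differentiableAt.differentiableWithinAt)
      (fun s hs => (hder s hs).deriv) ?_ ?_
    · rwa [mem_ball_zero_iff]
    · simp
  have h0 : h 0 = 1 := by
    have hs : ∀ a : ℕ → ℝ, ∑' n, a n * (0 : ℝ) ^ n = a 0 := fun a => by
      rw [tsum_eq_single 0 fun n hn => by simp [hn]]
      simp
    simp [hh, egfSeries, catSeries, hs, egfCoeff_zero]
  rw [h0, hh] at hconst
  have hne := catSeries_ne_zero ht
  have := (div_eq_one_iff_eq hne).1 hconst
  calc egfSeries t = egfSeries t * Real.exp (2 * t * catSeries t) *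
        Real.exp (-2 * t * catSeries t) := by
        rw [mul_assoc, ← Real.exp_add]
        ring_nf
        simp
    _ = _ := by rw [this]

end Analysis

/-- Let `μ n` be the Möbius function `μ_n(e, ·)` of the absolute order on
`S_n` (characterized by its defining recursion), and let
`χ n = μ_n(e, 1̂) = -∑_{x ∈ S_n} μ_n(e, x)` be the reduced Euler characteristic
of the order complex of the proper part of the absolute order with a maximum
element adjoined. Then `∑_{n ≥ 1} (-1)^n χ(n) tⁿ/n! = 1 - C(t) exp(-2t C(t))`
near `t = 0`. -/
theorem euler_characteristic_egf
    (μ : ∀ n : ℕ, Equiv.Perm (Fin n) → ℤ)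
    (hμ1 : ∀ n : ℕ, μ n 1 = 1)
    (hμ : ∀ (n : ℕ) (z : Equiv.Perm (Fin n)), z ≠ 1 →
      (∑ y : Equiv.Perm (Fin n), if AbsLe y z then μ n y else 0) = 0)
    (χ : ℕ → ℤ)
    (hχ : ∀ n : ℕ, 1 ≤ n → χ n = -∑ x : Equiv.Perm (Fin n), μ n x) :
    ∃ ε > (0 : ℝ), ∀ t : ℝ, t ≠ 0 → |t| < ε →
      HasSum
        (fun m : ℕ => (-1 : ℝ) ^ (m + 1) * (χ (m + 1) : ℝ) * t ^ (m + 1) /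
          (Nat.factorial (m + 1)))
        (1 - catGF t * Real.exp (-2 * t * catGF t)) := by
  refine ⟨1 / 16, by norm_num, fun t h0 ht => ?_⟩
  have hterm : ∀ m : ℕ, (-1 : ℝ) ^ (m + 1) * (χ (m + 1) : ℝ) * t ^ (m + 1) /
      (Nat.factorial (m + 1)) = -(egfCoeff (m + 1) * t ^ (m + 1)) := by
    intro m
    rw [hχ (m + 1) (by omega), sum_congr rfl fun x _ => moebius_eq_wt (hμ1 (m + 1)) (hμ (m + 1)) x,
      sum_wt cycMoebius_one, Fintype.card_fin, egfCoeff]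
    push_cast
    ring
  rw [funext hterm, catGF_eq ht h0, ← egfSeries_eq ht, ← neg_sub]
  refine HasSum.neg ?_
  have := (summable_norm_term egfCoeff_le ht).of_norm.hasSum
  rw [← hasSum_nat_add_iff' 1] at this
  simpa [egfCoeff_zero, egfSeries] using this
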